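/- Let n, m be natural numbers with n ≥ 2 and m ≥ 2. Define the 4×4 real matrices A₁ = blockdiag(R(2π/n), I₂) and A₂ = blockdiag(R(2π/m), I₂), where I₂ is the 2×2 identity. Then there do not exist linear subspaces Z₁, Z₂ of ℝ⁴ with Z₁ + Z₂ = ℝ⁴ such that A₂ · v = v for all v ∈ Z₁ and A₁ · v = v for all v ∈ Z₂. -/

import Mathlib

open Real

/-- A nontrivial rotation angle `2π/n` has cosine different from `1`. -/
theorem cos_two_pi_div_ne_one {n : ℕ} (hn : 2 ≤ n) : Real.cos (2 * π / n) ≠ 1 := by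
  have hn' : (2 : ℝ) ≤ n := by exact_mod_cast hn
  have hpos : 0 < 2 * π / n := by positivity
  have hlt : 2 * π / n < 2 * π := div_lt_self (by positivity) (by linarith)
  rw [Ne, Real.cos_eq_one_iff_of_lt_of_lt (by linarith) hlt]
  exact hpos.ne'

/-- A vector fixed by `blockdiag(R(θ), I₂)` with `cos θ ≠ 1` has vanishing first coordinate. -/
theorem apply_zero_eq_zero_of_rotation_fixed {θ : ℝ} (hθ : Real.cos θ ≠ 1) {v : Fin 4 → ℝ}
    (hv : (!![Real.cos θ, -Real.sin θ, 0, 0;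
              Real.sin θ, Real.cos θ, 0, 0;
              0, 0, 1, 0;
              0, 0, 0, 1] : Matrix (Fin 4) (Fin 4) ℝ).mulVec v = v) : v 0 = 0 := by
  have h0 := congrFun hv 0
  have h1 := congrFun hv 1
  simp [Matrix.mulVec, dotProduct, Fin.sum_univ_four] at h0 h1
  have hne : (Real.cos θ - 1) ^ 2 + Real.sin θ ^ 2 ≠ 0 := by
    have := sub_ne_zero.mpr hθ
    positivity
  refine (mul_eq_zero.mp ?_).resolve_left hne
  linear_combination (Real.cos θ - 1) * h0 + Real.sin θ * h1

/-- Case 2 of Appendix F: with `A₁ = blockdiag(R(2π/n), I₂)` and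
`A₂ = blockdiag(R(2π/m), I₂)` (`n, m ≥ 2`), there are no subspaces `Z₁, Z₂` of `ℝ⁴`
spanning `ℝ⁴` such that `A₂` fixes `Z₁` pointwise and `A₁` fixes `Z₂` pointwise. -/
theorem stmt_17 (n m : ℕ) (hn : 2 ≤ n) (hm : 2 ≤ m)
    (A₁ A₂ : Matrix (Fin 4) (Fin 4) ℝ)
    (hA₁ : A₁ = !![Real.cos (2 * π / n), -Real.sin (2 * π / n), 0, 0;
                   Real.sin (2 * π / n),  Real.cos (2 * π / n), 0, 0;
                   0, 0, 1, 0;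
                   0, 0, 0, 1])
    (hA₂ : A₂ = !![Real.cos (2 * π / m), -Real.sin (2 * π / m), 0, 0;
                   Real.sin (2 * π / m),  Real.cos (2 * π / m), 0, 0;
                   0, 0, 1, 0;
                   0, 0, 0, 1]) :
    ¬ ∃ Z₁ Z₂ : Submodule ℝ (Fin 4 → ℝ), Z₁ ⊔ Z₂ = ⊤ ∧
      (∀ v ∈ Z₁, A₂.mulVec v = v) ∧ (∀ v ∈ Z₂, A₁.mulVec v = v) := by
  rintro ⟨Z₁, Z₂, hsup, h₁, h₂⟩
  subst hA₁ hA₂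
  have hmem : (Pi.single 0 1 : Fin 4 → ℝ) ∈ Z₁ ⊔ Z₂ := hsup ▸ Submodule.mem_top
  obtain ⟨x, hx, y, hy, hxy⟩ := Submodule.mem_sup.mp hmem
  have hx0 := apply_zero_eq_zero_of_rotation_fixed (cos_two_pi_div_ne_one hm) (h₁ x hx)
  have hy0 := apply_zero_eq_zero_of_rotation_fixed (cos_two_pi_div_ne_one hn) (h₂ y hy)
  simpa [hx0, hy0] using congrFun hxy 0
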